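/- Let C = Av(312,321) and for σ ∈ C write g_σ(n) for the number of permutations of size n in C avoiding σ. Let β_j denote the permutation 2 3 ⋯ j 1 (j ≥ 2) and ι_i = 1 2 ⋯ i. Then: (a) for every j ≥ 2 and all σ, τ ∈ C, g_{β_j⊕σ}(n) = g_{β_j⊕τ}(n) for all n if and only if g_σ(n) = g_τ(n) for all n; and (b) for every i ≥ 1 and all σ, τ ∈ C each of which is either empty or satisfies σ(1) ≠ 1 (respectively τ(1) ≠ 1), g_{ι_i⊕σ}(n) = g_{ι_i⊕τ}(n) for all n if and only if g_σ(n) = g_τ(n) for all n. -/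

import Mathlib

/-- `l` is the one-line notation of a permutation of `{1, …, l.length}`. -/
def IsPermList (l : List ℕ) : Prop :=
  l.Perm ((List.range l.length).map (· + 1))

/-- `Involves σ τ` means the permutation (in one-line notation) `σ` is involved in `τ`
(written σ ≼ τ): there is a strictly increasing map of positions matching relative order. -/
def Involves (σ τ : List ℕ) : Prop :=
  ∃ f : Fin σ.length → Fin τ.length, StrictMono f ∧
    ∀ i j : Fin σ.length, σ.get i < σ.get j ↔ τ.get (f i) < τ.get (f j)

/-- Direct sum `σ ⊕ τ` of permutations in one-line notation. -/
def dsum (σ τ : List ℕ) : List ℕ := σ ++ τ.map (· + σ.length)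

/-- `β_j = 2 3 ⋯ j 1`, in one-line notation. -/
def beta (j : ℕ) : List ℕ := (List.range (j - 1)).map (· + 2) ++ [1]

/-- `ι_i = 1 2 ⋯ i`, the increasing permutation of size `i`. -/
def iota (i : ℕ) : List ℕ := (List.range i).map (· + 1)

/-- Membership in the class `C = Av(312, 321)`. -/
def InC (σ : List ℕ) : Prop :=
  IsPermList σ ∧ ¬ Involves [3, 1, 2] σ ∧ ¬ Involves [3, 2, 1] σ

/-- The number of permutations of size `n` in `Av(312, 321)` avoiding `σ`. -/
noncomputable def gcount (σ : List ℕ) (n : ℕ) : ℕ :=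
  Nat.card {l : List ℕ // l.length = n ∧ IsPermList l ∧
    ¬ Involves [3, 1, 2] l ∧ ¬ Involves [3, 2, 1] l ∧ ¬ Involves σ l}

lemma isPermList_iff {l : List ℕ} :
    IsPermList l ↔ l.Nodup ∧ ∀ x ∈ l, 1 ≤ x ∧ x ≤ l.length := by
  have hnd : ((List.range l.length).map (· + 1)).Nodup :=
    List.nodup_range.map (add_left_injective 1)
  constructor
  · intro h
    refine ⟨h.nodup_iff.2 hnd, fun x hx => ?_⟩
    have := h.mem_iff.1 hx
    simp only [List.mem_map, List.mem_range] at this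
    omega
  · rintro ⟨h, hx⟩
    refine (List.subperm_of_subset h fun x hxl => ?_).perm_of_length_le (by simp)
    have := hx x hxl
    simp only [List.mem_map, List.mem_range]
    exact ⟨x - 1, by omega, by omega⟩

lemma IsPermList.mem_iff {l : List ℕ} (h : IsPermList l) {x : ℕ} :
    x ∈ l ↔ 1 ≤ x ∧ x ≤ l.length := by
  refine ⟨(isPermList_iff.1 h).2 x, fun hx => ?_⟩
  rw [List.Perm.mem_iff h]
  simp only [List.mem_map, List.mem_range]
  exact ⟨x - 1, by omega, by omega⟩

lemma involves_iff {σ τ : List ℕ} :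
    Involves σ τ ↔ ∃ g : ℕ → ℕ, (∀ x ∈ σ, ∀ y ∈ σ, x < y → g x < g y) ∧ (σ.map g).Sublist τ := by
  constructor
  · rintro ⟨f, hf, h⟩
    let g : ℕ → ℕ := fun x =>
      if hx : σ.idxOf x < σ.length then τ.get (f ⟨σ.idxOf x, hx⟩) else 0
    have hg : ∀ i : Fin σ.length, g (σ.get i) = τ.get (f i) := by
      intro i
      have hi : σ.idxOf (σ.get i) < σ.length := List.idxOf_lt_length_iff.2 (List.get_mem _ _)
      have he : σ.get ⟨σ.idxOf (σ.get i), hi⟩ = σ.get i := by simp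
      simp only [g, dif_pos hi]
      have h1 := h ⟨_, hi⟩ i
      have h2 := h i ⟨_, hi⟩
      rw [he] at h1 h2
      omega
    refine ⟨g, ?_, ?_⟩
    · intro x hx y hy hxy
      obtain ⟨i, rfl⟩ := List.get_of_mem hx
      obtain ⟨j, rfl⟩ := List.get_of_mem hy
      rw [hg, hg]
      exact (h i j).1 hxy
    · rw [List.sublist_iff_exists_fin_orderEmbedding_get_eq]
      refine ⟨OrderEmbedding.ofStrictMono
        (fun i => f ⟨i.1, i.2.trans_eq (by simp)⟩) fun i j hij => hf hij, fun i => ?_⟩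
      rw [List.get_eq_getElem, List.getElem_map]
      exact hg ⟨i.1, i.2.trans_eq (by simp)⟩
  · rintro ⟨g, hg, hs⟩
    rw [List.sublist_iff_exists_fin_orderEmbedding_get_eq] at hs
    obtain ⟨f, hf⟩ := hs
    have hf' : ∀ i : Fin σ.length, τ.get (f ⟨i.1, by simp⟩) = g (σ.get i) := by
      intro i
      rw [← hf]
      simp
    refine ⟨fun i => f ⟨i.1, by simp⟩, fun i j hij => f.strictMono hij, fun i j => ?_⟩
    rw [hf', hf']
    refine ⟨hg _ (List.get_mem _ _) _ (List.get_mem _ _), fun hlt => ?_⟩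
    by_contra hle
    rcases (not_lt.1 hle).lt_or_eq with h | h
    · exact absurd (hg _ (List.get_mem _ _) _ (List.get_mem _ _) h) (by omega)
    · rw [h] at hlt
      exact lt_irrefl _ hlt

lemma Involves.mono_right {σ τ υ : List ℕ} (h : Involves σ τ) (hs : τ.Sublist υ) :
    Involves σ υ := by
  rw [involves_iff] at h ⊢
  obtain ⟨g, hg, hl⟩ := h
  exact ⟨g, hg, hl.trans hs⟩

lemma involves_refl (σ : List ℕ) : Involves σ σ := ⟨id, strictMono_id, fun _ _ => Iff.rfl⟩

lemma Involves.length_le {σ τ : List ℕ} (h : Involves σ τ) : σ.length ≤ τ.length := by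
  obtain ⟨g, -, hl⟩ := involves_iff.1 h
  simpa using hl.length_le

lemma involves_nil (τ : List ℕ) : Involves [] τ :=
  involves_iff.2 ⟨id, by simp, by simp⟩

lemma involves_map_add {σ τ : List ℕ} {k : ℕ} :
    Involves σ (τ.map (· + k)) ↔ Involves σ τ := by
  rw [involves_iff, involves_iff]
  constructor
  · rintro ⟨g, hg, hl⟩
    have hk : ∀ x ∈ σ, k ≤ g x := by
      intro x hx
      have := hl.subset (List.mem_map_of_mem hx)
      simp only [List.mem_map] at this
      omega
    refine ⟨fun x => g x - k, fun x hx y hy hxy => ?_, ?_⟩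
    · have := hg x hx y hy hxy
      have := hk x hx
      simp only
      omega
    · have := hl.map (· - k)
      simpa [List.map_map, Function.comp_def] using this
  · rintro ⟨g, hg, hl⟩
    refine ⟨fun x => g x + k, fun x hx y hy hxy => ?_, ?_⟩
    · have := hg x hx y hy hxy
      simp only
      omega
    · have := hl.map (· + k)
      simpa [List.map_map, Function.comp_def] using this

/-- A permutation lies in `Av(312, 321)` iff each of its entries is followed by at most one
smaller entry. -/
lemma inC_iff {l : List ℕ} :
    InC l ↔ IsPermList l ∧ ∀ x y z, [x, y, z].Sublist l → y < x → z < x → False := by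
  constructor
  · rintro ⟨hp, h1, h2⟩
    refine ⟨hp, fun x y z hs hy hz => ?_⟩
    have hnd := (isPermList_iff.1 hp).1.sublist hs
    have hne : y ≠ z := by
      rintro rfl
      simp at hnd
    rcases hne.lt_or_gt with hlt | hlt
    · refine h1 (involves_iff.2 ⟨fun n => if n = 3 then x else if n = 1 then y else z, ?_, ?_⟩)
      · simp [hy, hz, hlt]
      · simpa using hs
    · refine h2 (involves_iff.2 ⟨fun n => if n = 3 then x else if n = 2 then y else z, ?_, ?_⟩)
      · simp [hy, hz, hlt]
      · simpa using hs
  · rintro ⟨hp, h⟩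
    refine ⟨hp, fun hi => ?_, fun hi => ?_⟩
    all_goals
      obtain ⟨g, hg, hl⟩ := involves_iff.1 hi
      exact h _ _ _ hl (hg _ (by simp) _ (by simp) (by norm_num))
        (hg _ (by simp) _ (by simp) (by norm_num))

lemma length_dsum (σ τ : List ℕ) : (dsum σ τ).length = σ.length + τ.length := by
  simp [dsum]

lemma dsum_nil (σ : List ℕ) : dsum σ [] = σ := by simp [dsum]

lemma InC.dsum {P R : List ℕ} (hP : InC P) (hR : InC R) : InC (dsum P R) := by
  rw [inC_iff] at *
  obtain ⟨hp, hP⟩ := hP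
  obtain ⟨hr, hR⟩ := hR
  constructor
  · rw [isPermList_iff, length_dsum]
    constructor
    · refine List.Nodup.append (isPermList_iff.1 hp).1
        ((isPermList_iff.1 hr).1.map (add_left_injective _)) fun x hx hx' => ?_
      have := hp.mem_iff.1 hx
      obtain ⟨y, hy, rfl⟩ := List.mem_map.1 hx'
      have := hr.mem_iff.1 hy
      omega
    · intro x hx
      rcases List.mem_append.1 hx with hx | hx
      · have := hp.mem_iff.1 hx
        omega
      · obtain ⟨y, hy, rfl⟩ := List.mem_map.1 hx
        have := hr.mem_iff.1 hy
        omega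
  · intro x y z hs hy hz
    obtain ⟨l₁, l₂, he, h₁, h₂⟩ := List.sublist_append_iff.1 hs
    have key : ∀ a ∈ l₁, ∀ b ∈ l₂, a < b := by
      intro a ha b hb
      have := hp.mem_iff.1 (h₁.subset ha)
      obtain ⟨c, hc, rfl⟩ := List.mem_map.1 (h₂.subset hb)
      have := hr.mem_iff.1 hc
      omega
    match l₁, he with
    | [], he =>
      obtain rfl : [x, y, z] = l₂ := by simpa using he
      obtain ⟨l, hl, he⟩ := List.sublist_map_iff.1 h₂
      match l, he with
      | [a, b, c], he =>
        simp only [List.map_cons, List.map_nil, List.cons.injEq, and_true] at he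
        exact hR a b c hl (by omega) (by omega)
    | [a], he =>
      simp only [List.cons_append, List.nil_append, List.cons.injEq] at he
      obtain ⟨rfl, rfl⟩ := he
      have := key x (by simp) y (by simp)
      omega
    | [a, b], he =>
      simp only [List.cons_append, List.nil_append, List.cons.injEq] at he
      obtain ⟨rfl, rfl, rfl⟩ := he
      have := key x (by simp) z (by simp)
      omega
    | a :: b :: c :: l, he =>
      simp only [List.cons_append, List.cons.injEq] at he
      obtain ⟨rfl, rfl, rfl, he⟩ := he
      obtain ⟨rfl, -⟩ : l = [] ∧ l₂ = [] := by simpa using he.symm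
      exact hP x y z h₁ hy hz

/-- A prefix of a permutation in the class that is itself a permutation splits off as a
direct summand. -/
lemma InC.exists_dsum {P S : List ℕ} (h : InC (P ++ S)) (hP : IsPermList P) :
    InC P ∧ ∃ R, InC R ∧ S = R.map (· + P.length) := by
  rw [inC_iff] at h
  obtain ⟨hp, h⟩ := h
  refine ⟨inC_iff.2 ⟨hP, fun x y z hs => h x y z (hs.trans (List.sublist_append_left _ _))⟩, ?_⟩
  obtain ⟨hnd, hm⟩ := isPermList_iff.1 hp
  have hS : ∀ x ∈ S, P.length < x ∧ x ≤ P.length + S.length := by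
    intro x hx
    have h1 := hm x (by simp [hx])
    have h2 : x ∉ P := fun hx' => (List.nodup_append.1 hnd).2.2 x hx' x hx rfl
    rw [hP.mem_iff] at h2
    simp only [List.length_append] at h1
    omega
  have he : S = (S.map (· - P.length)).map (· + P.length) := by
    rw [List.map_map]
    conv_lhs => rw [← List.map_id S]
    refine List.map_congr_left fun x hx => ?_
    have := hS x hx
    simp only [id, Function.comp]
    omega
  refine ⟨S.map (· - P.length), ?_, he⟩
  rw [inC_iff, isPermList_iff]
  refine ⟨⟨?_, ?_⟩, ?_⟩
  · have hnS := (List.nodup_append.1 hnd).2.1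
    rw [he] at hnS
    exact hnS.of_map
  · intro x hx
    obtain ⟨y, hy, rfl⟩ := List.mem_map.1 hx
    have := hS y hy
    simp only [List.length_map]
    omega
  · intro x y z hs hy hz
    have hs' := hs.map (· + P.length)
    rw [← he] at hs'
    exact h _ _ _ (hs'.trans (List.sublist_append_right _ _)) (by simpa using hy)
      (by simpa using hz)

lemma isPermList_of_append_of_lt {A B : List ℕ} (h : IsPermList (A ++ B))
    (hlt : ∀ a ∈ A, ∀ b ∈ B, a < b) : IsPermList A := by
  obtain ⟨hnd, hm⟩ := isPermList_iff.1 h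
  refine isPermList_iff.2 ⟨(List.nodup_append.1 hnd).1, fun x hx => ?_⟩
  have hx1 := hm x (by simp [hx])
  refine ⟨hx1.1, ?_⟩
  have hsub : Finset.Icc 1 x ⊆ A.toFinset := by
    intro y hy
    rw [Finset.mem_Icc] at hy
    have hy' : y ∈ A ++ B := h.mem_iff.2 ⟨hy.1, hy.2.trans hx1.2⟩
    rcases List.mem_append.1 hy' with hy' | hy'
    · simpa using hy'
    · have := hlt x hx y hy'
      omega
  simpa using (Finset.card_le_card hsub).trans (List.toFinset_card_le A)

lemma involves_dsum {ρ σ P R : List ℕ} (hρ : IsPermList ρ) (hσ : IsPermList σ)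
    (hP : IsPermList P) (hR : IsPermList R) (h₁ : Involves ρ P) (h₂ : Involves σ R) :
    Involves (dsum ρ σ) (dsum P R) := by
  rw [involves_iff] at *
  obtain ⟨g₁, hg₁, hs₁⟩ := h₁
  obtain ⟨g₂, hg₂, hs₂⟩ := h₂
  let g : ℕ → ℕ := fun x =>
    if x ≤ ρ.length then g₁ x else g₂ (x - ρ.length) + P.length
  have e₁ : ∀ x ∈ ρ, g x = g₁ x := fun x hx => if_pos (hρ.mem_iff.1 hx).2
  have e₂ : ∀ x ∈ σ, g (x + ρ.length) = g₂ x + P.length := by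
    intro x hx
    have := hσ.mem_iff.1 hx
    simp only [g]
    rw [if_neg (by omega), Nat.add_sub_cancel]
  refine ⟨g, ?_, ?_⟩
  · intro x hx y hy hxy
    rcases List.mem_append.1 hx with hx | hx <;> rcases List.mem_append.1 hy with hy | hy
    · rw [e₁ x hx, e₁ y hy]
      exact hg₁ x hx y hy hxy
    · obtain ⟨y, hy', rfl⟩ := List.mem_map.1 hy
      rw [e₁ x hx, e₂ y hy']
      have := hP.mem_iff.1 (hs₁.subset (List.mem_map_of_mem hx))
      have := hR.mem_iff.1 (hs₂.subset (List.mem_map_of_mem hy'))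
      omega
    · obtain ⟨x, hx, rfl⟩ := List.mem_map.1 hx
      have := hρ.mem_iff.1 hy
      omega
    · obtain ⟨x, hx', rfl⟩ := List.mem_map.1 hx
      obtain ⟨y, hy', rfl⟩ := List.mem_map.1 hy
      rw [e₂ x hx', e₂ y hy']
      have := hg₂ x hx' y hy' (by omega)
      omega
  · have m₁ : ρ.map g = ρ.map g₁ := List.map_congr_left e₁
    have m₂ : (σ.map (· + ρ.length)).map g = (σ.map g₂).map (· + P.length) := by
      rw [List.map_map, List.map_map]
      exact List.map_congr_left e₂
    rw [dsum, List.map_append, m₁, m₂]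
    exact hs₁.append (hs₂.map _)

/-- Every occurrence of `ρ ⊕ σ` in a member of the class is separated by a direct sum
decomposition of that member. -/
def Separates (ρ σ : List ℕ) : Prop :=
  ∀ τ, InC τ → Involves (dsum ρ σ) τ →
    ∃ P S, τ = P ++ S ∧ IsPermList P ∧ Involves ρ P ∧ Involves σ S

lemma exists_of_involves_dsum {ρ σ τ : List ℕ} (hρ : IsPermList ρ) (hσ : IsPermList σ)
    (h : Involves (dsum ρ σ) τ) : ∃ g₁ g₂ : ℕ → ℕ,
      (∀ x ∈ ρ, ∀ y ∈ ρ, x < y → g₁ x < g₁ y) ∧ (∀ x ∈ σ, ∀ y ∈ σ, x < y → g₂ x < g₂ y) ∧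
      (∀ x ∈ ρ, ∀ y ∈ σ, g₁ x < g₂ y) ∧ (ρ.map g₁ ++ σ.map g₂).Sublist τ := by
  obtain ⟨g, hg, hs⟩ := involves_iff.1 h
  refine ⟨g, fun x => g (x + ρ.length), fun x hx y hy hxy => ?_, fun x hx y hy hxy => ?_,
    fun x hx y hy => ?_, ?_⟩
  · exact hg x (by simp [dsum, hx]) y (by simp [dsum, hy]) hxy
  · exact hg _ (by simp [dsum, hx]) _ (by simp [dsum, hy]) (by omega)
  · have := hρ.mem_iff.1 hx
    have := hσ.mem_iff.1 hy
    exact hg _ (by simp [dsum, hx]) _ (by simp [dsum, hy]) (by omega)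
  · simpa [dsum, Function.comp_def] using hs

lemma mem_beta {j x : ℕ} (hj : 1 ≤ j) : x ∈ beta j ↔ 1 ≤ x ∧ x ≤ j := by
  simp only [beta, List.mem_append, List.mem_map, List.mem_range, List.mem_singleton]
  constructor
  · rintro (⟨a, ha, rfl⟩ | rfl) <;> omega
  · intro h
    by_cases h1 : x = 1
    · exact Or.inr h1
    · exact Or.inl ⟨x - 2, by omega, by omega⟩

lemma inC_beta {j : ℕ} (hj : 1 ≤ j) : InC (beta j) := by
  have hlen : (beta j).length = j := by
    simp only [beta, List.length_append, List.length_map, List.length_range, List.length_singleton]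
    omega
  have hmono : ((List.range (j - 1)).map (· + 2)).Pairwise (· < ·) :=
    List.pairwise_lt_range.map _ fun a b hab => by omega
  rw [inC_iff, isPermList_iff]
  refine ⟨⟨?_, fun x hx => by rw [hlen]; exact (mem_beta hj).1 hx⟩, ?_⟩
  · refine List.Nodup.append (hmono.imp fun h => h.ne) (by simp) ?_
    simp
  · intro x y z hs hy _
    obtain ⟨l₁, l₂, he, h₁, h₂⟩ := List.sublist_append_iff.1 hs
    have hl : l₂.length ≤ 1 := h₂.length_le
    have hp := hmono.sublist h₁
    match l₁, he with
    | [], he =>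
      have := congrArg List.length he
      simp only [List.length_cons, List.length_nil, List.nil_append] at this
      omega
    | [a], he =>
      have := congrArg List.length he
      simp only [List.length_cons, List.length_nil, List.length_append] at this
      omega
    | a :: b :: l, he =>
      simp only [List.cons_append, List.cons.injEq] at he
      obtain ⟨rfl, rfl, -⟩ := he
      have : x < y := by
        simp only [List.pairwise_cons, List.mem_cons, forall_eq_or_imp] at hp
        exact hp.1.1
      omega

lemma inC_iota (i : ℕ) : InC (iota i) := by
  have hmono : (iota i).Pairwise (· < ·) :=
    List.pairwise_lt_range.map _ fun a b hab => by omega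
  rw [inC_iff]
  refine ⟨by simp [IsPermList, iota], fun x y z hs hy _ => ?_⟩
  have hp := hmono.sublist hs
  simp only [List.pairwise_cons, List.mem_cons, forall_eq_or_imp] at hp
  exact absurd hp.1.1 (by omega)

lemma separates_beta {j : ℕ} (hj : 2 ≤ j) {σ : List ℕ} (hσ : IsPermList σ) :
    Separates (beta j) σ := by
  intro τ hτ h
  have hβ := (inC_beta (j := j) (by omega)).1
  obtain ⟨g₁, g₂, hg₁, hg₂, -, hs⟩ := exists_of_involves_dsum hβ hσ h
  have h21 : g₁ 1 < g₁ 2 :=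
    hg₁ 1 ((mem_beta (by omega)).2 (by omega)) 2 ((mem_beta (by omega)).2 (by omega)) (by omega)
  have h2 : g₁ 2 ∈ ((List.range (j - 1)).map (· + 2)).map g₁ :=
    List.mem_map_of_mem (List.mem_map.2 ⟨0, List.mem_range.2 (by omega), rfl⟩)
  have he : (beta j).map g₁ = ((List.range (j - 1)).map (· + 2)).map g₁ ++ [g₁ 1] := by
    simp [beta]
  rw [he, List.append_assoc] at hs
  obtain ⟨A, B, rfl, hA, hB⟩ := List.append_sublist_iff.1 hs
  obtain ⟨C, D, rfl, hC, hD⟩ := List.cons_sublist_iff.1 hB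
  obtain ⟨s, t, rfl⟩ := List.append_of_mem hC
  have e : A ++ (s ++ g₁ 1 :: t ++ D) = (A ++ s ++ [g₁ 1]) ++ (t ++ D) := by simp
  rw [e] at hτ ⊢
  obtain ⟨hp, h3⟩ := inC_iff.1 hτ
  refine ⟨_, _, rfl, isPermList_of_append_of_lt hp fun a ha b hb => ?_, ?_, ?_⟩
  · by_contra hab
    have hne : a ≠ b := (List.nodup_append.1 (isPermList_iff.1 hp).1).2.2 a ha b hb
    have aux : ∀ x ∈ A ++ s, g₁ 1 < x → b < x → False := by
      intro x hx h1 h2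
      refine h3 x (g₁ 1) b ?_ h1 h2
      exact ((List.singleton_sublist.2 hx).append (List.Sublist.refl [g₁ 1])).append
        (List.singleton_sublist.2 hb)
    have hav : a ≤ g₁ 1 := by
      rcases List.mem_append.1 ha with ha | ha
      · by_contra hlt
        exact aux a ha (by omega) (by omega)
      · exact (List.mem_singleton.1 ha).le
    exact aux (g₁ 2) (List.mem_append_left _ (hA.subset h2)) h21 (by omega)
  · refine involves_iff.2 ⟨g₁, hg₁, ?_⟩
    rw [he]
    exact (hA.trans (List.sublist_append_left _ _)).append (List.Sublist.refl _)
  · exact involves_iff.2 ⟨g₂, hg₂, hD.trans (List.sublist_append_right _ _)⟩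

lemma eq_filter_append_filter {p : ℕ → Bool} {l : List ℕ}
    (h : ∀ a b, [a, b].Sublist l → p b → p a) : l = l.filter p ++ l.filter (fun x => !p x) := by
  induction l with
  | nil => rfl
  | cons x l ih =>
    have ih := ih fun a b hab => h a b (hab.trans (List.sublist_cons_self _ _))
    by_cases hx : p x
    · simpa [hx] using ih
    · have hl : ∀ y ∈ l, ¬ p y := fun y hy hpy =>
        hx (h x y (by simpa using hy) hpy)
      have h1 : l.filter p = [] := List.filter_eq_nil_iff.2 hl
      rw [h1] at ih
      simpa [hx, h1] using ih

/-- In a member of the class, the entries smaller than the lower entry `v` of a descent `u, v`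
precede all the others. -/
lemma InC.lt_of_lt_of_descent {τ : List ℕ} (hτ : InC τ) {u v a b : ℕ} (huv : [u, v].Sublist τ)
    (hvu : v < u) (hab : [a, b].Sublist τ) (hb : b < v) : a < v := by
  obtain ⟨hp, h3⟩ := inC_iff.1 hτ
  obtain ⟨X, Z, rfl, hu, hv⟩ := List.cons_sublist_iff.1 huv
  obtain ⟨s, Y, rfl⟩ := List.append_of_mem (List.singleton_sublist.1 hv)
  rw [← List.append_assoc] at hp h3 hab
  have hnd := (isPermList_iff.1 hp).1
  by_contra hav
  have hbY : b ∉ v :: Y := by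
    intro hb'
    rcases List.mem_cons.1 hb' with rfl | hb'
    · exact lt_irrefl _ hb
    · refine h3 u v b ?_ hvu (by omega)
      exact (List.singleton_sublist.2 (List.mem_append_left s hu)).append
        ((List.singleton_sublist.2 hb').cons_cons v)
  have habX : [a, b].Sublist (X ++ s) := by
    obtain ⟨l₁, l₂, he, h₁, h₂⟩ := List.sublist_append_iff.1 hab
    rcases List.eq_nil_or_concat l₂ with rfl | ⟨l, c, rfl⟩
    · rw [List.append_nil] at he
      rwa [he]
    · have hc : b = c := by
        have := congrArg List.getLast? he
        simpa [← List.append_assoc] using this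
      exact absurd (h₂.subset (by simp [hc])) hbY
  have hne : a ≠ v :=
    (List.nodup_append.1 hnd).2.2 a (habX.subset (by simp)) v (by simp)
  exact h3 a b v (habX.append (List.singleton_sublist.2 (by simp : v ∈ v :: Y)))
    (by omega) (by omega)

lemma separates_iota (i : ℕ) {σ : List ℕ} (hσ : IsPermList σ)
    (h1 : σ = [] ∨ σ.head? ≠ some 1) : Separates (iota i) σ := by
  intro τ hτ h
  rcases σ with _ | ⟨s, σ⟩
  · rw [dsum_nil] at h
    exact ⟨τ, [], by simp, hτ.1, h, involves_nil _⟩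
  have hs1 : s ≠ 1 := by simpa using h1
  have hone : 1 ∈ s :: σ := hσ.mem_iff.2 (by simp)
  have honeσ : 1 ∈ σ := (List.mem_cons.1 hone).resolve_left hs1.symm
  have hs0 := hσ.mem_iff.1 (List.mem_cons_self (a := s) (l := σ))
  obtain ⟨g₁, g₂, hg₁, hg₂, hg, hs⟩ := exists_of_involves_dsum (inC_iota i).1 hσ h
  have hdesc : [g₂ s, g₂ 1].Sublist τ := by
    refine List.Sublist.trans ?_ ((List.sublist_append_right _ _).trans hs)
    rw [List.map_cons]
    exact (List.singleton_sublist.2 (List.mem_map_of_mem honeσ)).cons_cons _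
  have hvu : g₂ 1 < g₂ s := hg₂ 1 hone s (by simp) (by omega)
  have hfil := eq_filter_append_filter (p := fun x => decide (x < g₂ 1)) (l := τ)
    fun a b hab hb => by
      simp only [decide_eq_true_eq] at hb ⊢
      exact hτ.lt_of_lt_of_descent hdesc hvu hab hb
  refine ⟨_, _, hfil, ?_, involves_iff.2 ⟨g₁, hg₁, ?_⟩, involves_iff.2 ⟨g₂, hg₂, ?_⟩⟩
  · refine isPermList_of_append_of_lt (hfil ▸ hτ.1) fun a ha b hb => ?_
    simp only [List.mem_filter, decide_eq_true_eq, Bool.not_eq_true', decide_eq_false_iff_not]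
      at ha hb
    omega
  · have := ((List.sublist_append_left _ _).trans hs).filter (fun x => decide (x < g₂ 1))
    rwa [List.filter_eq_self.2] at this
    intro a ha
    obtain ⟨x, hx, rfl⟩ := List.mem_map.1 ha
    simpa using hg x hx 1 hone
  · have := ((List.sublist_append_right _ _).trans hs).filter (fun x => !decide (x < g₂ 1))
    rwa [List.filter_eq_self.2] at this
    intro a ha
    obtain ⟨x, hx, rfl⟩ := List.mem_map.1 ha
    have hx1 := hσ.mem_iff.1 hx
    rcases hx1.1.eq_or_lt with rfl | hlt
    · simp
    · simpa using (hg₂ 1 hone x hx hlt).le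

lemma finite_inC (n : ℕ) : {l : List ℕ | l.length = n ∧ InC l}.Finite := by
  refine (((List.range n).map (· + 1)).permutations.toFinset.finite_toSet).subset ?_
  rintro l ⟨rfl, hl⟩
  simpa [IsPermList] using hl.1

open Classical in
/-- The members of size `n` of the class with property `p`. -/
noncomputable def classFinset (p : List ℕ → Prop) (n : ℕ) : Finset (List ℕ) :=
  (finite_inC n).toFinset.filter p

lemma mem_classFinset {p : List ℕ → Prop} {n : ℕ} {l : List ℕ} :
    l ∈ classFinset p n ↔ (l.length = n ∧ InC l) ∧ p l := by
  simp [classFinset]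

lemma gcount_add_card (σ : List ℕ) (n : ℕ) :
    gcount σ n + (classFinset (Involves σ) n).card = (finite_inC n).toFinset.card := by
  classical
  have h : gcount σ n = (classFinset (fun l => ¬ Involves σ l) n).card := by
    rw [gcount, ← Nat.card_eq_finsetCard]
    refine Nat.card_congr (Equiv.subtypeEquivRight fun l => ?_)
    rw [mem_classFinset, InC]
    tauto
  rw [h, add_comm]
  convert Finset.card_filter_add_card_filter_not (s := (finite_inC n).toFinset) (Involves σ) <;>
    · ext l
      simp [classFinset]

/-- `P` involves `ρ`, but none of its proper prefixes that are permutations does. -/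
def MinInvolves (ρ P : List ℕ) : Prop :=
  Involves ρ P ∧ ∀ Q S, P = Q ++ S → IsPermList Q → Involves ρ Q → S = []

lemma exists_minInvolves {ρ P : List ℕ} (hP : IsPermList P) (h : Involves ρ P) :
    ∃ Q S, P = Q ++ S ∧ IsPermList Q ∧ MinInvolves ρ Q := by
  induction hn : P.length using Nat.strong_induction_on generalizing P with
  | _ n ih =>
    by_cases hmin : MinInvolves ρ P
    · exact ⟨P, [], by simp, hP, hmin⟩
    · simp only [MinInvolves, h, true_and, not_forall] at hmin
      obtain ⟨Q, S, rfl, hQ, hρQ, hS⟩ := hmin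
      have := List.length_pos_iff.2 hS
      obtain ⟨Q', S', rfl, hQ', hm⟩ := ih Q.length
        (by rw [← hn, List.length_append]; omega) hQ hρQ rfl
      exact ⟨Q', S' ++ S, by simp, hQ', hm⟩

lemma card_involves_dsum {ρ σ : List ℕ} (hρ : InC ρ) (hσ : InC σ) (hsep : Separates ρ σ) (n : ℕ) :
    (classFinset (Involves (dsum ρ σ)) n).card = ∑ p ∈ Finset.HasAntidiagonal.antidiagonal n,
      (classFinset (MinInvolves ρ) p.1).card * (classFinset (Involves σ) p.2).card := by
  simp only [← Finset.card_product]
  rw [← Finset.card_sigma]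
  symm
  refine Finset.card_bij (fun x _ => dsum x.2.1 x.2.2) ?_ ?_ ?_
  · rintro ⟨⟨k, m⟩, P, R⟩ hx
    simp only [Finset.mem_sigma, Finset.HasAntidiagonal.mem_antidiagonal, Finset.mem_product,
      mem_classFinset] at hx ⊢
    obtain ⟨hn, ⟨⟨hk, hP⟩, hρP, -⟩, ⟨hm, hR⟩, hσR⟩ := hx
    exact ⟨⟨by rw [length_dsum, hk, hm, hn], hP.dsum hR⟩,
      involves_dsum hρ.1 hσ.1 hP.1 hR.1 hρP hσR⟩
  · rintro ⟨⟨k, m⟩, P, R⟩ hx ⟨⟨k', m'⟩, P', R'⟩ hx' he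
    simp only [Finset.mem_sigma, Finset.HasAntidiagonal.mem_antidiagonal, Finset.mem_product,
      mem_classFinset] at hx hx' he
    obtain ⟨-, ⟨⟨rfl, hP⟩, hρP, hmin⟩, ⟨rfl, -⟩, -⟩ := hx
    obtain ⟨-, ⟨⟨rfl, hP'⟩, hρP', hmin'⟩, ⟨rfl, -⟩, -⟩ := hx'
    have hPP : P = P' := by
      rcases List.append_eq_append_iff.1 he with ⟨S, h, -⟩ | ⟨S, h, -⟩
      · have := hmin' P S h hP.1 hρP
        simpa [this] using h.symm
      · have := hmin P' S h hP'.1 hρP'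
        simpa [this] using h
    subst hPP
    have hRR : R = R' :=
      List.map_injective_iff.2 (add_left_injective P.length) (List.append_cancel_left he)
    subst hRR
    rfl
  · intro τ hτ
    obtain ⟨⟨hn, hC⟩, hi⟩ := mem_classFinset.1 hτ
    obtain ⟨P, S, rfl, hP, hρP, hσS⟩ := hsep τ hC hi
    obtain ⟨Q, T, rfl, hQ, hm⟩ := exists_minInvolves hP hρP
    rw [List.append_assoc] at hC
    obtain ⟨hQC, R, hR, he⟩ := hC.exists_dsum hQ
    have hσR : Involves σ R := by
      rw [← involves_map_add (k := Q.length), ← he]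
      exact hσS.mono_right (List.sublist_append_right _ _)
    have hd : dsum Q R = Q ++ T ++ S := by rw [dsum, ← he, List.append_assoc]
    refine ⟨⟨(Q.length, R.length), Q, R⟩, ?_, hd⟩
    simp only [Finset.mem_sigma, Finset.HasAntidiagonal.mem_antidiagonal, Finset.mem_product, mem_classFinset]
    exact ⟨by rw [← hn, ← hd, length_dsum], ⟨⟨trivial, hQC⟩, hm⟩, ⟨trivial, hR⟩, hσR⟩

lemma minInvolves_self (ρ : List ℕ) : MinInvolves ρ ρ := by
  refine ⟨involves_refl ρ, fun Q S h _ hQ => ?_⟩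
  have h1 := congrArg List.length h
  have h2 := hQ.length_le
  rw [List.length_append] at h1
  exact List.length_eq_zero_iff.1 (by omega)

lemma gcount_eq_iff {σ τ : List ℕ} : (∀ n, gcount σ n = gcount τ n) ↔
    ∀ n, (classFinset (Involves σ) n).card = (classFinset (Involves τ) n).card := by
  refine forall_congr' fun n => ?_
  have h1 := gcount_add_card σ n
  have h2 := gcount_add_card τ n
  omega

lemma gcount_dsum_eq_iff {ρ σ τ : List ℕ} (hρ : InC ρ) (hσ : InC σ) (hτ : InC τ)
    (hσs : Separates ρ σ) (hτs : Separates ρ τ) :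
    (∀ n, gcount (dsum ρ σ) n = gcount (dsum ρ τ) n) ↔ ∀ n, gcount σ n = gcount τ n := by
  rw [gcount_eq_iff, gcount_eq_iff]
  let F : (List ℕ → Prop) → PowerSeries ℤ := fun p =>
    PowerSeries.mk fun n => ((classFinset p n).card : ℤ)
  have hF : ∀ p q : List ℕ → Prop,
      F p = F q ↔ ∀ n, (classFinset p n).card = (classFinset q n).card := by
    intro p q
    simp [F, PowerSeries.ext_iff]
  have hmul : ∀ υ, InC υ → Separates ρ υ →
      F (Involves (dsum ρ υ)) = F (MinInvolves ρ) * F (Involves υ) := by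
    intro υ hυ hυs
    ext n
    simp [F, PowerSeries.coeff_mul, card_involves_dsum hρ hυ hυs]
  have hne : F (MinInvolves ρ) ≠ 0 := by
    intro h0
    have h := congrArg (PowerSeries.coeff ρ.length) h0
    have hmem : ρ ∈ classFinset (MinInvolves ρ) ρ.length :=
      mem_classFinset.2 ⟨⟨rfl, hρ⟩, minInvolves_self ρ⟩
    have := Finset.card_pos.2 ⟨ρ, hmem⟩
    simp only [F, PowerSeries.coeff_mk, map_zero] at h
    omega
  rw [← hF, ← hF, hmul σ hσ hσs, hmul τ hτ hτs, mul_right_inj' hne]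

/-- Cancellation of the first summand in `Av(312, 321)`:
(a) `β_j ⊕ σ` and `β_j ⊕ τ` are Wilf-equivalent iff `σ` and `τ` are;
(b) for `σ, τ` empty or not beginning with the value 1, `ι_i ⊕ σ` and `ι_i ⊕ τ`
are Wilf-equivalent iff `σ` and `τ` are. -/
theorem cancel_first_summand :
    (∀ j : ℕ, 2 ≤ j → ∀ σ τ : List ℕ, InC σ → InC τ →
      ((∀ n : ℕ, gcount (dsum (beta j) σ) n = gcount (dsum (beta j) τ) n) ↔
        (∀ n : ℕ, gcount σ n = gcount τ n))) ∧
    (∀ i : ℕ, 1 ≤ i → ∀ σ τ : List ℕ, InC σ → InC τ →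
      (σ = [] ∨ σ.head? ≠ some 1) → (τ = [] ∨ τ.head? ≠ some 1) →
      ((∀ n : ℕ, gcount (dsum (iota i) σ) n = gcount (dsum (iota i) τ) n) ↔
        (∀ n : ℕ, gcount σ n = gcount τ n))) := by
  constructor
  · intro j hj σ τ hσ hτ
    exact gcount_dsum_eq_iff (inC_beta (by omega)) hσ hτ (separates_beta hj hσ.1)
      (separates_beta hj hτ.1)
  · intro i _ σ τ hσ hτ hσ1 hτ1
    exact gcount_dsum_eq_iff (inC_iota i) hσ hτ (separates_iota i hσ.1 hσ1)
      (separates_iota i hτ.1 hτ1)
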